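/- For all M, N ∈ ℕ with M > N, the family Θ̄_{N,M} is a (12N/M + 8/√N + 4/N, d_EM)-covering of Θ̄: for every binary-signal conditionally independent information structure θ ∈ Θ̄, there exists θ' ∈ Θ̄_{N,M} such that d_EM(P_θ, P_{θ'}) ≤ 12N/M + 8/√N + 4/N. -/

import Mathlib

open Finset

/-- An information structure with a binary state `ω : Bool` (prior `μ = P(ω = 1)`) and two
signals `s1 : S1`, `s2 : S2` that are conditionally independent given the state,
encoded by the joint mass function `P`. -/
structure InfoStruct (S1 S2 : Type) [Fintype S1] [Fintype S2] : Type where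
  P : Bool → S1 → S2 → ℝ
  nonneg : ∀ ω s1 s2, 0 ≤ P ω s1 s2
  sum_one : ∑ ω : Bool, ∑ s1 : S1, ∑ s2 : S2, P ω s1 s2 = 1
  condIndep : ∀ ω s1 s2,
    (∑ t1 : S1, ∑ t2 : S2, P ω t1 t2) * P ω s1 s2 =
      (∑ t2 : S2, P ω s1 t2) * (∑ t1 : S1, P ω t1 s2)

namespace InfoStruct

variable {S1 S2 : Type} [Fintype S1] [Fintype S2]

/-- The prior `μ = P(ω = 1)`. -/
def prior (θ : InfoStruct S1 S2) : ℝ := ∑ s1 : S1, ∑ s2 : S2, θ.P true s1 s2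

/-- The marginal probability of a signal pair `(s1, s2)`. -/
def pSig (θ : InfoStruct S1 S2) (s1 : S1) (s2 : S2) : ℝ := ∑ ω : Bool, θ.P ω s1 s2

/-- The marginal probability of agent 1's signal. -/
def p1 (θ : InfoStruct S1 S2) (s1 : S1) : ℝ := ∑ ω : Bool, ∑ s2 : S2, θ.P ω s1 s2

/-- The marginal probability of agent 2's signal. -/
def p2 (θ : InfoStruct S1 S2) (s2 : S2) : ℝ := ∑ ω : Bool, ∑ s1 : S1, θ.P ω s1 s2

/-- Agent 1's report `x1 = P(ω = 1 | s1)`. -/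
noncomputable def x1 (θ : InfoStruct S1 S2) (s1 : S1) : ℝ :=
  (∑ s2 : S2, θ.P true s1 s2) / θ.p1 s1

/-- Agent 2's report `x2 = P(ω = 1 | s2)`. -/
noncomputable def x2 (θ : InfoStruct S1 S2) (s2 : S2) : ℝ :=
  (∑ s1 : S1, θ.P true s1 s2) / θ.p2 s2

/-- The posterior `P(ω = 1 | s1, s2)`. -/
noncomputable def post (θ : InfoStruct S1 S2) (s1 : S1) (s2 : S2) : ℝ :=
  θ.P true s1 s2 / θ.pSig s1 s2

/-- Expectation of a function of the report pair `(x1, x2)` under `θ`. -/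
noncomputable def expect (θ : InfoStruct S1 S2) (h : ℝ → ℝ → ℝ) : ℝ :=
  ∑ s1 : S1, ∑ s2 : S2, θ.pSig s1 s2 * h (θ.x1 s1) (θ.x2 s2)

/-- Probability that the report pair `(x1, x2)` lies in a set `A ⊆ ℝ²`. -/
noncomputable def probR (θ : InfoStruct S1 S2) (A : Set (ℝ × ℝ)) : ℝ :=
  ∑ s1 : S1, ∑ s2 : S2, A.indicator (fun _ => θ.pSig s1 s2) (θ.x1 s1, θ.x2 s2)

end InfoStruct

/-- Earth mover's (Wasserstein-1) distance, w.r.t. the ℓ1 metric, between the report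
distributions of two information structures:
`d_EM(P,Q) = ⨆_{‖h‖_Lip ≤ 1} (E_P[h] - E_Q[h])`. -/
noncomputable def dEM {S1 S2 T1 T2 : Type} [Fintype S1] [Fintype S2] [Fintype T1] [Fintype T2]
    (θ : InfoStruct S1 S2) (θ' : InfoStruct T1 T2) : ℝ :=
  sSup {r : ℝ | ∃ h : ℝ → ℝ → ℝ,
    (∀ a b a' b', |h a b - h a' b'| ≤ |a - a'| + |b - b'|) ∧
    r = θ.expect h - θ'.expect h}

/-- `r` lies in the discrete grid `[1/N] = {0, 1/N, 2/N, …, 1}`. -/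
def inGrid (N : ℕ) (r : ℝ) : Prop := ∃ k : ℕ, k ≤ N ∧ r = (k : ℝ) / N

/-- Membership in `Θ̄_N`: all reports of the binary-signal information structure lie in the
grid `[1/N]`. -/
def reportsInGrid (N : ℕ) (θ : InfoStruct Bool Bool) : Prop :=
  (∀ s1 : Bool, inGrid N (θ.x1 s1)) ∧ (∀ s2 : Bool, inGrid N (θ.x2 s2))

/-- The probability of state `ω` when state `true` has probability `x`. -/
def stateProb (ω : Bool) (x : ℝ) : ℝ := bif ω then x else 1 - x

@[simp] lemma stateProb_true (x : ℝ) : stateProb true x = x := rfl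

@[simp] lemma stateProb_false (x : ℝ) : stateProb false x = 1 - x := rfl

lemma stateProb_nonneg (ω : Bool) {x : ℝ} (h0 : 0 ≤ x) (h1 : x ≤ 1) : 0 ≤ stateProb ω x := by
  cases ω <;> simp <;> linarith

lemma stateProb_pos (ω : Bool) {x : ℝ} (h0 : 0 < x) (h1 : x < 1) : 0 < stateProb ω x := by
  cases ω <;> simp <;> linarith

lemma sum_mul_stateProb {ι : Type} [Fintype ι] {p x : ι → ℝ} {μ : ℝ}
    (hp : ∑ i, p i = 1) (hx : ∑ i, p i * x i = μ) (ω : Bool) :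
    ∑ i, p i * stateProb ω (x i) = stateProb ω μ := by
  cases ω
  · simp [mul_sub, Finset.sum_sub_distrib, hp, hx]
  · simpa using hx

/-- `p` is a distribution over reports `x i ∈ [0, 1]` whose mean is the prior `μ`. -/
structure IsReportLaw {ι : Type} [Fintype ι] (μ : ℝ) (p x : ι → ℝ) : Prop where
  nonneg : ∀ i, 0 ≤ p i
  sum_eq : ∑ i, p i = 1
  report_nonneg : ∀ i, 0 ≤ x i
  report_le : ∀ i, x i ≤ 1
  mean_eq : ∑ i, p i * x i = μ

namespace IsReportLaw

variable {ι : Type} [Fintype ι] {μ : ℝ} {p x : ι → ℝ}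

lemma weight_nonneg (hp : IsReportLaw μ p x) (ω : Bool) (i : ι) :
    0 ≤ p i * stateProb ω (x i) :=
  mul_nonneg (hp.nonneg i) (stateProb_nonneg ω (hp.report_nonneg i) (hp.report_le i))

lemma sum_weight (hp : IsReportLaw μ p x) (ω : Bool) :
    ∑ i, p i * stateProb ω (x i) = stateProb ω μ :=
  sum_mul_stateProb hp.sum_eq hp.mean_eq ω

lemma sum_weight_div (hp : IsReportLaw μ p x) (h0 : 0 < μ) (h1 : μ < 1) (ω : Bool) :
    ∑ i, p i * stateProb ω (x i) / stateProb ω μ = 1 := by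
  rw [← Finset.sum_div, hp.sum_weight, div_self (stateProb_pos ω h0 h1).ne']

lemma sum_mul_weight_div (hp : IsReportLaw μ p x) (h0 : 0 < μ) (h1 : μ < 1) (ω : Bool) (c : ℝ) :
    ∑ i, c * (p i * stateProb ω (x i)) / stateProb ω μ = c := by
  rw [← Finset.sum_div, ← Finset.mul_sum, hp.sum_weight,
    mul_div_cancel_right₀ _ (stateProb_pos ω h0 h1).ne']

lemma mean_mem (hp : IsReportLaw μ p x) {L H : ℝ} (hx : ∀ i, L ≤ x i ∧ x i ≤ H) :
    L ≤ μ ∧ μ ≤ H := by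
  have e : ∀ c : ℝ, c = ∑ i, p i * c := fun c => by rw [← Finset.sum_mul, hp.sum_eq, one_mul]
  rw [← hp.mean_eq, e L, e H]
  exact ⟨Finset.sum_le_sum fun i _ => mul_le_mul_of_nonneg_left (hx i).1 (hp.nonneg i),
    Finset.sum_le_sum fun i _ => mul_le_mul_of_nonneg_left (hx i).2 (hp.nonneg i)⟩

end IsReportLaw

/-- The conditionally independent information structure with prior `μ` and given laws of the
two reports. -/
noncomputable def InfoStruct.ofReports {ι κ : Type} [Fintype ι] [Fintype κ] {μ : ℝ}
    {p x : ι → ℝ} {q y : κ → ℝ} (h0 : 0 < μ) (h1 : μ < 1)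
    (hp : IsReportLaw μ p x) (hq : IsReportLaw μ q y) : InfoStruct ι κ where
  P ω i j := p i * stateProb ω (x i) * (q j * stateProb ω (y j)) / stateProb ω μ
  nonneg ω i j := div_nonneg (mul_nonneg (hp.weight_nonneg ω i) (hq.weight_nonneg ω j))
    (stateProb_pos ω h0 h1).le
  sum_one := by
    have h : ∀ ω, ∑ i, ∑ j, p i * stateProb ω (x i) * (q j * stateProb ω (y j)) / stateProb ω μ
        = stateProb ω μ := fun ω => by
      simp_rw [hq.sum_mul_weight_div h0 h1, hp.sum_weight]
    simp_rw [h]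
    simp
  condIndep ω i j := by
    have hm := (stateProb_pos ω h0 h1).ne'
    have e1 : ∀ i, ∑ j, p i * stateProb ω (x i) * (q j * stateProb ω (y j)) / stateProb ω μ
        = p i * stateProb ω (x i) := fun i => hq.sum_mul_weight_div h0 h1 ω _
    have e2 : ∑ i, p i * stateProb ω (x i) * (q j * stateProb ω (y j)) / stateProb ω μ
        = q j * stateProb ω (y j) := by
      rw [← Finset.sum_div, ← Finset.sum_mul, hp.sum_weight]
      field_simp
    simp_rw [e1, e2, hp.sum_weight]
    field_simp

section ofReports

variable {ι κ : Type} [Fintype ι] [Fintype κ] {μ : ℝ} {p x : ι → ℝ} {q y : κ → ℝ}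
  (h0 : 0 < μ) (h1 : μ < 1) (hp : IsReportLaw μ p x) (hq : IsReportLaw μ q y)

lemma ofReports_sum_right (ω : Bool) (i : ι) :
    ∑ j, (InfoStruct.ofReports h0 h1 hp hq).P ω i j = p i * stateProb ω (x i) :=
  hq.sum_mul_weight_div h0 h1 ω _

lemma ofReports_sum_left (ω : Bool) (j : κ) :
    ∑ i, (InfoStruct.ofReports h0 h1 hp hq).P ω i j = q j * stateProb ω (y j) := by
  have hm := (stateProb_pos ω h0 h1).ne'
  simp_rw [InfoStruct.ofReports]
  rw [← Finset.sum_div, ← Finset.sum_mul, hp.sum_weight]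
  field_simp

lemma ofReports_prior : (InfoStruct.ofReports h0 h1 hp hq).prior = μ := by
  simp_rw [InfoStruct.prior, ofReports_sum_right, hp.sum_weight, stateProb_true]

lemma ofReports_p1 (i : ι) : (InfoStruct.ofReports h0 h1 hp hq).p1 i = p i := by
  simp_rw [InfoStruct.p1, ofReports_sum_right]
  simp
  ring

lemma ofReports_p2 (j : κ) : (InfoStruct.ofReports h0 h1 hp hq).p2 j = q j := by
  simp_rw [InfoStruct.p2, ofReports_sum_left]
  simp
  ring

lemma ofReports_x1 {i : ι} (hi : p i ≠ 0) :
    (InfoStruct.ofReports h0 h1 hp hq).x1 i = x i := by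
  rw [InfoStruct.x1, ofReports_p1, ofReports_sum_right, stateProb_true, mul_div_cancel_left₀ _ hi]

lemma ofReports_x2 {j : κ} (hj : q j ≠ 0) :
    (InfoStruct.ofReports h0 h1 hp hq).x2 j = y j := by
  rw [InfoStruct.x2, ofReports_p2, ofReports_sum_left, stateProb_true, mul_div_cancel_left₀ _ hj]

end ofReports

/-- Expectation of `h` under prior `μ` and report laws `(p, x)`, `(q, y)` that are conditionally
independent given the state. -/
noncomputable def reportExpect {ι κ : Type} [Fintype ι] [Fintype κ] (μ : ℝ) (p x : ι → ℝ)
    (q y : κ → ℝ) (h : ℝ → ℝ → ℝ) : ℝ :=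
  ∑ i, p i * ∑ ω, stateProb ω (x i) *
    ∑ j, q j * stateProb ω (y j) / stateProb ω μ * h (x i) (y j)

lemma reportExpect_swap {ι κ : Type} [Fintype ι] [Fintype κ] (μ : ℝ) (p x : ι → ℝ)
    (q y : κ → ℝ) (h : ℝ → ℝ → ℝ) :
    reportExpect μ p x q y h = reportExpect μ q y p x (fun a b => h b a) := by
  simp_rw [reportExpect, Finset.mul_sum]
  rw [Finset.sum_comm]
  conv_rhs => rw [Finset.sum_comm]
  refine Finset.sum_congr rfl fun ω _ => ?_
  rw [Finset.sum_comm]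
  refine Finset.sum_congr rfl fun j _ => Finset.sum_congr rfl fun i _ => ?_
  ring

lemma expect_ofReports {ι κ : Type} [Fintype ι] [Fintype κ] {μ : ℝ} {p x : ι → ℝ}
    {q y : κ → ℝ} (h0 : 0 < μ) (h1 : μ < 1) (hp : IsReportLaw μ p x) (hq : IsReportLaw μ q y)
    (hp' : ∀ i, p i ≠ 0) (hq' : ∀ j, q j ≠ 0) (h : ℝ → ℝ → ℝ) :
    (InfoStruct.ofReports h0 h1 hp hq).expect h = reportExpect μ p x q y h := by
  simp_rw [InfoStruct.expect, reportExpect, ofReports_x1 h0 h1 hp hq (hp' _),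
    ofReports_x2 h0 h1 hp hq (hq' _), InfoStruct.pSig, InfoStruct.ofReports, Finset.mul_sum,
    Finset.sum_mul]
  refine Finset.sum_congr rfl fun i _ => ?_
  rw [Finset.sum_comm]
  refine Finset.sum_congr rfl fun ω _ => Finset.sum_congr rfl fun j _ => ?_
  ring

namespace InfoStruct

variable {S1 S2 : Type} [Fintype S1] [Fintype S2] (θ : InfoStruct S1 S2)

lemma p1_nonneg (i : S1) : 0 ≤ θ.p1 i :=
  Finset.sum_nonneg fun ω _ => Finset.sum_nonneg fun j _ => θ.nonneg ω i j

lemma p2_nonneg (j : S2) : 0 ≤ θ.p2 j :=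
  Finset.sum_nonneg fun ω _ => Finset.sum_nonneg fun i _ => θ.nonneg ω i j

lemma p1_mul_stateProb (ω : Bool) (i : S1) :
    θ.p1 i * stateProb ω (θ.x1 i) = ∑ j, θ.P ω i j := by
  have hn : ∀ ω, 0 ≤ ∑ j, θ.P ω i j := fun ω => Finset.sum_nonneg fun j _ => θ.nonneg ω i j
  have e : θ.p1 i = ∑ j, θ.P true i j + ∑ j, θ.P false i j := by simp [p1]
  have ht := hn true
  have hf := hn false
  by_cases h : θ.p1 i = 0
  · rw [h, zero_mul]
    cases ω <;> linarith
  · cases ω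
    · rw [stateProb_false, mul_sub, x1, mul_div_cancel₀ _ h]
      linarith
    · rw [stateProb_true, x1, mul_div_cancel₀ _ h]

lemma p2_mul_stateProb (ω : Bool) (j : S2) :
    θ.p2 j * stateProb ω (θ.x2 j) = ∑ i, θ.P ω i j := by
  have hn : ∀ ω, 0 ≤ ∑ i, θ.P ω i j := fun ω => Finset.sum_nonneg fun i _ => θ.nonneg ω i j
  have e : θ.p2 j = ∑ i, θ.P true i j + ∑ i, θ.P false i j := by simp [p2]
  have ht := hn true
  have hf := hn false
  by_cases h : θ.p2 j = 0
  · rw [h, zero_mul]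
    cases ω <;> linarith
  · cases ω
    · rw [stateProb_false, mul_sub, x2, mul_div_cancel₀ _ h]
      linarith
    · rw [stateProb_true, x2, mul_div_cancel₀ _ h]

lemma isReportLaw_one : IsReportLaw θ.prior θ.p1 θ.x1 where
  nonneg := θ.p1_nonneg
  sum_eq := by
    simp_rw [p1]
    rw [Finset.sum_comm]
    exact θ.sum_one
  report_nonneg i := div_nonneg (Finset.sum_nonneg fun j _ => θ.nonneg true i j) (θ.p1_nonneg i)
  report_le i := div_le_one_of_le₀ (by
    have : 0 ≤ ∑ j, θ.P false i j := Finset.sum_nonneg fun j _ => θ.nonneg false i j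
    simp [p1, this]) (θ.p1_nonneg i)
  mean_eq := by
    have := θ.p1_mul_stateProb true
    simp only [stateProb_true] at this
    simp_rw [this]
    rfl

lemma isReportLaw_two : IsReportLaw θ.prior θ.p2 θ.x2 where
  nonneg := θ.p2_nonneg
  sum_eq := by
    simp_rw [p2]
    rw [Finset.sum_comm, ← θ.sum_one]
    exact Finset.sum_congr rfl fun ω _ => Finset.sum_comm
  report_nonneg j := div_nonneg (Finset.sum_nonneg fun i _ => θ.nonneg true i j) (θ.p2_nonneg j)
  report_le j := div_le_one_of_le₀ (by
    have : 0 ≤ ∑ i, θ.P false i j := Finset.sum_nonneg fun i _ => θ.nonneg false i j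
    simp [p2, this]) (θ.p2_nonneg j)
  mean_eq := by
    have := θ.p2_mul_stateProb true
    simp only [stateProb_true] at this
    simp_rw [this]
    exact Finset.sum_comm

lemma sum_P_eq (ω : Bool) : ∑ i, ∑ j, θ.P ω i j = stateProb ω θ.prior := by
  simp_rw [← θ.p1_mul_stateProb, θ.isReportLaw_one.sum_weight]

lemma expect_eq_reportExpect (h0 : 0 < θ.prior) (h1 : θ.prior < 1) (h : ℝ → ℝ → ℝ) :
    θ.expect h = reportExpect θ.prior θ.p1 θ.x1 θ.p2 θ.x2 h := by
  have hP : ∀ ω i j, θ.P ω i j = θ.p1 i * stateProb ω (θ.x1 i) *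
      (θ.p2 j * stateProb ω (θ.x2 j)) / stateProb ω θ.prior := fun ω i j => by
    rw [eq_div_iff (stateProb_pos ω h0 h1).ne', p1_mul_stateProb, p2_mul_stateProb, mul_comm,
      ← sum_P_eq]
    exact θ.condIndep ω i j
  simp_rw [expect, reportExpect, pSig, hP, Finset.mul_sum, Finset.sum_mul]
  refine Finset.sum_congr rfl fun i _ => ?_
  rw [Finset.sum_comm]
  refine Finset.sum_congr rfl fun ω _ => Finset.sum_congr rfl fun j _ => ?_
  ring

lemma expect_sub_const (h : ℝ → ℝ → ℝ) (c : ℝ) :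
    θ.expect (fun a b => h a b - c) = θ.expect h - c := by
  have : ∑ i, ∑ j, θ.pSig i j = 1 := by
    rw [← θ.isReportLaw_one.sum_eq]
    exact Finset.sum_congr rfl fun i _ => Finset.sum_comm
  simp_rw [expect, mul_sub, Finset.sum_sub_distrib, ← Finset.sum_mul, this, one_mul]

end InfoStruct

/-- Splitting a report `x ∈ [L, H]` into reports `L` and `H` with mean `x` costs at most twice the
distance from `x` to the nearer endpoint. -/
lemma abs_sub_split_le {G : Bool → ℝ → ℝ} (hG : ∀ ω a b, |G ω a - G ω b| ≤ |a - b|)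
    {L H x d : ℝ} (hL : 0 ≤ L) (hH : H ≤ 1) (hLH : L < H) (hLx : L ≤ x) (hxH : x ≤ H)
    (hd : x - L ≤ d ∨ H - x ≤ d) :
    |∑ ω, stateProb ω x * G ω x -
      ((H - x) / (H - L) * ∑ ω, stateProb ω L * G ω L +
        (x - L) / (H - L) * ∑ ω, stateProb ω H * G ω H)| ≤ 2 * d := by
  have hD : 0 < H - L := by linarith
  set α := (H - x) / (H - L) with hα
  set β := (x - L) / (H - L) with hβ
  have hα0 : 0 ≤ α := div_nonneg (by linarith) hD.le
  have hβ0 : 0 ≤ β := div_nonneg (by linarith) hD.le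
  have hαβ : α + β = 1 := by rw [hα, hβ]; field_simp; ring
  have hx : x = α * L + β * H := by rw [hα, hβ]; field_simp; ring
  have hαn : α * (x - L) = β * (H - x) := by
    rw [hα, hβ]; field_simp
  have hmix : ∀ ω, stateProb ω x = α * stateProb ω L + β * stateProb ω H := fun ω => by
    cases ω
    · simp only [stateProb_false]; linear_combination -hx - hαβ
    · simpa using hx
  have key : ∀ ω, |stateProb ω x * G ω x - (α * (stateProb ω L * G ω L) +
      β * (stateProb ω H * G ω H))| ≤
      stateProb ω L * (α * (x - L)) + stateProb ω H * (β * (H - x)) := fun ω => by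
    have e : stateProb ω x * G ω x - (α * (stateProb ω L * G ω L) + β * (stateProb ω H * G ω H))
        = α * stateProb ω L * (G ω x - G ω L) + β * stateProb ω H * (G ω x - G ω H) := by
      rw [hmix]; ring
    have w1 : 0 ≤ stateProb ω L := stateProb_nonneg ω hL (by linarith)
    have w2 : 0 ≤ stateProb ω H := stateProb_nonneg ω (by linarith) hH
    have g1 := hG ω x L
    have g2 := hG ω x H
    rw [abs_of_nonneg (by linarith : 0 ≤ x - L)] at g1
    rw [abs_sub_comm x H, abs_of_nonneg (by linarith : 0 ≤ H - x)] at g2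
    rw [e]
    refine (abs_add_le _ _).trans ?_
    rw [abs_mul (α * stateProb ω L), abs_mul (β * stateProb ω H),
      abs_of_nonneg (mul_nonneg hα0 w1), abs_of_nonneg (mul_nonneg hβ0 w2)]
    have := mul_le_mul_of_nonneg_left g1 (mul_nonneg hα0 w1)
    have := mul_le_mul_of_nonneg_left g2 (mul_nonneg hβ0 w2)
    linarith
  have hfin : α * (x - L) + β * (H - x) ≤ 2 * d := by
    rcases hd with hd | hd
    · nlinarith
    · nlinarith
  have k1 := key true
  have k2 := key false
  simp only [Fintype.sum_bool]
  calc _ = |(stateProb true x * G true x - (α * (stateProb true L * G true L) +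
      β * (stateProb true H * G true H))) + (stateProb false x * G false x -
      (α * (stateProb false L * G false L) + β * (stateProb false H * G false H)))| := by
        congr 1; ring
    _ ≤ _ := abs_add_le _ _
    _ ≤ _ := add_le_add k1 k2
    _ = α * (x - L) + β * (H - x) := by simp; ring
    _ ≤ 2 * d := hfin

/-- The two-point report `H` (for `true`) or `L` (for `false`). -/
def twoPoint (L H : ℝ) (k : Bool) : ℝ := bif k then H else L

/-- The distribution on `{L, H}` with mean `μ`. -/
noncomputable def twoPointLaw (L H μ : ℝ) (k : Bool) : ℝ :=
  bif k then (μ - L) / (H - L) else (H - μ) / (H - L)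

lemma isReportLaw_twoPoint {L H μ : ℝ} (hL : 0 ≤ L) (hH : H ≤ 1) (hLH : L < H) (hLμ : L ≤ μ)
    (hμH : μ ≤ H) : IsReportLaw μ (twoPointLaw L H μ) (twoPoint L H) := by
  have hD : 0 < H - L := by linarith
  refine ⟨fun i => ?_, ?_, fun i => ?_, fun i => ?_, ?_⟩
  · cases i <;> exact div_nonneg (by linarith) hD.le
  · simp [twoPointLaw]; field_simp; ring
  · cases i <;> simp [twoPoint] <;> linarith
  · cases i <;> simp [twoPoint] <;> linarith
  · simp [twoPointLaw, twoPoint]; field_simp; ring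

lemma twoPointLaw_pos {L H μ : ℝ} (hLμ : L < μ) (hμH : μ < H) (k : Bool) :
    0 < twoPointLaw L H μ k := by
  cases k <;> exact div_pos (by linarith) (by linarith)

lemma sum_abs_twoPointLaw_sub {L H d : ℝ} (hd : 0 < d) (hLH : d ≤ H - L) (μ μ' : ℝ) :
    ∑ k, |twoPointLaw L H μ k - twoPointLaw L H μ' k| ≤ 2 * (|μ - μ'| / d) := by
  have e1 : twoPointLaw L H μ true - twoPointLaw L H μ' true = (μ - μ') / (H - L) := by
    simp [twoPointLaw]; ring
  have e2 : twoPointLaw L H μ false - twoPointLaw L H μ' false = -((μ - μ') / (H - L)) := by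
    simp [twoPointLaw]; ring
  rw [Fintype.sum_bool, e1, e2, abs_neg, abs_div, abs_of_pos (by linarith : 0 < H - L)]
  have : |μ - μ'| / (H - L) ≤ |μ - μ'| / d := by gcongr
  linarith

/-- Replacing the first report by a two-point spread of it moves expectations of `1`-Lipschitz
functions by at most twice the distance of the reports to the endpoints. -/
lemma abs_reportExpect_sub_twoPoint_le {ι κ : Type} [Fintype ι] [Fintype κ] {μ : ℝ}
    (h0 : 0 < μ) (h1 : μ < 1) {p x : ι → ℝ} {q y : κ → ℝ} (hp : IsReportLaw μ p x)
    (hq : IsReportLaw μ q y) {h : ℝ → ℝ → ℝ}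
    (hh : ∀ a b a' b', |h a b - h a' b'| ≤ |a - a'| + |b - b'|)
    {L H d : ℝ} (hL : 0 ≤ L) (hH : H ≤ 1) (hLH : L < H) (hx : ∀ i, L ≤ x i ∧ x i ≤ H)
    (hd : ∀ i, x i - L ≤ d ∨ H - x i ≤ d) :
    |reportExpect μ p x q y h - reportExpect μ (twoPointLaw L H μ) (twoPoint L H) q y h|
      ≤ 2 * d := by
  set G : Bool → ℝ → ℝ := fun ω a => ∑ j, q j * stateProb ω (y j) / stateProb ω μ * h a (y j)
    with hGdef
  have hG : ∀ ω a b, |G ω a - G ω b| ≤ |a - b| := fun ω a b => by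
    simp only [hGdef]
    rw [← Finset.sum_sub_distrib]
    refine (Finset.abs_sum_le_sum_abs _ _).trans ?_
    calc _ ≤ ∑ j, q j * stateProb ω (y j) / stateProb ω μ * |a - b| := by
          refine Finset.sum_le_sum fun j _ => ?_
          have hw : 0 ≤ q j * stateProb ω (y j) / stateProb ω μ :=
            div_nonneg (hq.weight_nonneg ω j) (stateProb_pos ω h0 h1).le
          rw [← mul_sub, abs_mul, abs_of_nonneg hw]
          have := hh a (y j) b (y j)
          rw [sub_self, abs_zero, add_zero] at this
          gcongr
      _ = |a - b| := by rw [← Finset.sum_mul, hq.sum_weight_div h0 h1, one_mul]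
  set V : ℝ → ℝ := fun a => ∑ ω, stateProb ω a * G ω a with hV
  have e1 : reportExpect μ p x q y h = ∑ i, p i * V (x i) := rfl
  have e2 : reportExpect μ (twoPointLaw L H μ) (twoPoint L H) q y h =
      ∑ i, p i * ((H - x i) / (H - L) * V L + (x i - L) / (H - L) * V H) := by
    have a1 : ∑ i, p i * ((H - x i) / (H - L) * V L + (x i - L) / (H - L) * V H) =
        ∑ i, (p i * ((H * V L - L * V H) / (H - L)) + p i * x i * ((V H - V L) / (H - L))) :=
      Finset.sum_congr rfl fun i _ => by ring
    have a2 : reportExpect μ (twoPointLaw L H μ) (twoPoint L H) q y h =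
        (μ - L) / (H - L) * V H + (H - μ) / (H - L) * V L := by
      rw [reportExpect, Fintype.sum_bool]
      rfl
    rw [a1, a2, Finset.sum_add_distrib, ← Finset.sum_mul, ← Finset.sum_mul, hp.sum_eq, hp.mean_eq]
    ring
  rw [e1, e2, ← Finset.sum_sub_distrib]
  refine (Finset.abs_sum_le_sum_abs _ _).trans ?_
  calc _ ≤ ∑ i, p i * (2 * d) := by
        refine Finset.sum_le_sum fun i _ => ?_
        rw [← mul_sub, abs_mul, abs_of_nonneg (hp.nonneg i)]
        exact mul_le_mul_of_nonneg_left
          (abs_sub_split_le hG hL hH hLH (hx i).1 (hx i).2 (hd i)) (hp.nonneg i)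
    _ = 2 * d := by rw [← Finset.sum_mul, hp.sum_eq, one_mul]

/-- Stability of conditionally independent expectations under a change of prior and of report
probabilities, the report values being fixed. -/
lemma abs_reportExpect_sub_le {ι κ : Type} [Fintype ι] [Fintype κ] {μ μ' : ℝ}
    (h0 : 0 < μ) (h1 : μ < 1) (h0' : 0 < μ') (h1' : μ' < 1) {p p' x : ι → ℝ} {q q' y : κ → ℝ}
    (hp' : IsReportLaw μ' p' x) (hq : IsReportLaw μ q y)
    {h : ℝ → ℝ → ℝ} (hh : ∀ i j, |h (x i) (y j)| ≤ 1) :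
    |reportExpect μ p x q y h - reportExpect μ' p' x q' y h| ≤
      ∑ i, |p i - p' i| + ∑ j, |q j - q' j| + 2 * |μ - μ'| := by
  have hm := fun ω => stateProb_pos ω h0 h1
  have hm' := fun ω => stateProb_pos ω h0' h1'
  set A : ℝ := ∑ i, (p i - p' i) * ∑ ω, stateProb ω (x i) *
    ∑ j, q j * stateProb ω (y j) / stateProb ω μ * h (x i) (y j) with hA
  set B : ℝ := ∑ ω, ∑ j, ((q j - q' j) * stateProb ω (y j) +
    (stateProb ω μ' - stateProb ω μ) * (q j * stateProb ω (y j) / stateProb ω μ)) *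
    ∑ i, p' i * stateProb ω (x i) / stateProb ω μ' * h (x i) (y j) with hB
  have hsplit : reportExpect μ p x q y h - reportExpect μ' p' x q' y h = A + B := by
    have : B = ∑ i, p' i * ∑ ω, stateProb ω (x i) *
        ∑ j, (q j * stateProb ω (y j) / stateProb ω μ - q' j * stateProb ω (y j) / stateProb ω μ')
          * h (x i) (y j) := by
      rw [hB]
      simp_rw [Finset.mul_sum]
      rw [Finset.sum_comm_cycle]
      refine Finset.sum_congr rfl fun i _ => Finset.sum_congr rfl fun ω _ =>
        Finset.sum_congr rfl fun j _ => ?_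
      have := (hm ω).ne'
      have := (hm' ω).ne'
      field_simp
      ring
    rw [this, hA, reportExpect, reportExpect, ← Finset.sum_add_distrib, ← Finset.sum_sub_distrib]
    refine Finset.sum_congr rfl fun i _ => ?_
    simp only [sub_mul, Finset.sum_sub_distrib, mul_sub]
    ring
  have hAle : |A| ≤ ∑ i, |p i - p' i| := by
    refine (Finset.abs_sum_le_sum_abs _ _).trans (Finset.sum_le_sum fun i _ => ?_)
    rw [abs_mul]
    refine mul_le_of_le_one_right (abs_nonneg _) ?_
    have hin : ∀ ω, |∑ j, q j * stateProb ω (y j) / stateProb ω μ * h (x i) (y j)| ≤ 1 := by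
      intro ω
      rw [← hq.sum_weight_div h0 h1 ω]
      refine (Finset.abs_sum_le_sum_abs _ _).trans (Finset.sum_le_sum fun j _ => ?_)
      have hw : 0 ≤ q j * stateProb ω (y j) / stateProb ω μ :=
        div_nonneg (hq.weight_nonneg ω j) (hm ω).le
      rw [abs_mul, abs_of_nonneg hw]
      exact mul_le_of_le_one_right hw (hh i j)
    have hw := fun ω => stateProb_nonneg ω (hp'.report_nonneg i) (hp'.report_le i)
    refine (Finset.abs_sum_le_sum_abs _ _).trans ?_
    calc _ ≤ ∑ ω, stateProb ω (x i) := Finset.sum_le_sum fun ω _ => by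
          rw [abs_mul, abs_of_nonneg (hw ω)]
          exact mul_le_of_le_one_right (hw ω) (hin ω)
      _ = 1 := by simp
  have hBle : |B| ≤ ∑ j, |q j - q' j| + 2 * |μ - μ'| := by
    have hin : ∀ ω j, |∑ i, p' i * stateProb ω (x i) / stateProb ω μ' * h (x i) (y j)| ≤ 1 := by
      intro ω j
      rw [← hp'.sum_weight_div h0' h1' ω]
      refine (Finset.abs_sum_le_sum_abs _ _).trans (Finset.sum_le_sum fun i _ => ?_)
      have hw : 0 ≤ p' i * stateProb ω (x i) / stateProb ω μ' :=
        div_nonneg (hp'.weight_nonneg ω i) (hm' ω).le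
      rw [abs_mul, abs_of_nonneg hw]
      exact mul_le_of_le_one_right hw (hh i j)
    have hdiff : ∀ ω, |stateProb ω μ' - stateProb ω μ| = |μ - μ'| := fun ω => by
      cases ω
      · congr 1; simp
      · rw [abs_sub_comm]; rfl
    have hstep : ∀ ω, |∑ j, ((q j - q' j) * stateProb ω (y j) +
        (stateProb ω μ' - stateProb ω μ) * (q j * stateProb ω (y j) / stateProb ω μ)) *
        ∑ i, p' i * stateProb ω (x i) / stateProb ω μ' * h (x i) (y j)| ≤
        ∑ j, |q j - q' j| * stateProb ω (y j) + |μ - μ'| := fun ω => by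
      refine (Finset.abs_sum_le_sum_abs _ _).trans ?_
      calc _ ≤ ∑ j, (|q j - q' j| * stateProb ω (y j) +
            |μ - μ'| * (q j * stateProb ω (y j) / stateProb ω μ)) :=
            Finset.sum_le_sum fun j _ => by
              have hw := stateProb_nonneg ω (hq.report_nonneg j) (hq.report_le j)
              have hw' : 0 ≤ q j * stateProb ω (y j) / stateProb ω μ :=
                div_nonneg (hq.weight_nonneg ω j) (hm ω).le
              rw [abs_mul]
              refine (mul_le_of_le_one_right (abs_nonneg _) (hin ω j)).trans ?_
              refine (abs_add_le _ _).trans_eq ?_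
              rw [abs_mul, abs_mul, abs_of_nonneg hw, abs_of_nonneg hw', hdiff]
        _ = _ := by
          rw [Finset.sum_add_distrib, ← Finset.mul_sum, hq.sum_weight_div h0 h1, mul_one]
    refine (Finset.abs_sum_le_sum_abs _ _).trans ((Finset.sum_le_sum fun ω _ => hstep ω).trans_eq ?_)
    rw [Finset.sum_add_distrib, Finset.sum_comm]
    simp_rw [← Finset.mul_sum]
    simp
  rw [hsplit]
  exact (abs_add_le _ _).trans (by linarith)

/-- Grid endpoints enclosing two reports and the grid cell `[k/N, (k+1)/N]` of the prior. -/
lemma exists_grid_endpoints {N : ℕ} (hN : 1 ≤ N) {μ : ℝ} {p x : Bool → ℝ}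
    (hp : IsReportLaw μ p x) (h1 : μ < 1) :
    ∃ l r : ℕ, l ≤ ⌊N * μ⌋₊ ∧ ⌊N * μ⌋₊ + 1 ≤ r ∧ r ≤ N ∧
      (∀ i, (l : ℝ) / N ≤ x i ∧ x i ≤ (r : ℝ) / N) ∧
      ∀ i, x i - (l : ℝ) / N ≤ 1 / N ∨ (r : ℝ) / N - x i ≤ 1 / N := by
  have hN0 : (0 : ℝ) < N := by exact_mod_cast hN
  obtain ⟨i₀, i₁, hle, hall, hmin, hmax⟩ : ∃ i₀ i₁, x i₀ ≤ x i₁ ∧ (∀ i, i = i₀ ∨ i = i₁) ∧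
      x i₀ ≤ μ ∧ μ ≤ x i₁ := by
    have e1 := hp.sum_eq
    have e2 := hp.mean_eq
    rw [Fintype.sum_bool] at e1 e2
    have n1 := hp.nonneg true
    have n2 := hp.nonneg false
    rcases le_total (x false) (x true) with hle | hle
    · exact ⟨false, true, hle, by decide, by nlinarith, by nlinarith⟩
    · exact ⟨true, false, hle, by decide, by nlinarith, by nlinarith⟩
  have hμ0 : 0 ≤ μ := (hp.report_nonneg i₀).trans hmin
  have hl := Nat.floor_le (mul_nonneg hN0.le (hp.report_nonneg i₀))
  have hl' := Nat.lt_floor_add_one (N * x i₀)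
  have hr := Nat.floor_le (mul_nonneg hN0.le (hp.report_nonneg i₁))
  have hr' := Nat.lt_floor_add_one (N * x i₁)
  have hx1 := hp.report_le i₁
  have hlow : ((⌊N * x i₀⌋₊ : ℕ) : ℝ) / N ≤ x i₀ := by
    rw [div_le_iff₀ hN0]; linarith
  have hup : x i₁ ≤ ((min (⌊N * x i₁⌋₊ + 1) N : ℕ) : ℝ) / N := by
    rw [le_div_iff₀ hN0]
    push_cast
    exact le_min (by linarith) (by nlinarith)
  refine ⟨⌊N * x i₀⌋₊, min (⌊N * x i₁⌋₊ + 1) N, Nat.floor_mono (by gcongr), ?_, min_le_right _ _,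
    fun i => ?_, fun i => ?_⟩
  · refine le_min (Nat.succ_le_succ (Nat.floor_mono (by gcongr))) ?_
    rw [Nat.succ_le_iff, Nat.floor_lt (mul_nonneg hN0.le hμ0)]
    nlinarith
  · rcases hall i with rfl | rfl
    · exact ⟨hlow, hle.trans hup⟩
    · exact ⟨hlow.trans hle, hup⟩
  · rcases hall i with rfl | rfl
    · left
      rw [sub_le_iff_le_add, ← add_div, le_div_iff₀ hN0]
      linarith
    · right
      rw [sub_le_iff_le_add', div_le_iff₀ hN0, add_mul, one_div, inv_mul_cancel₀ hN0.ne']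
      push_cast
      exact (min_le_left _ _).trans (by linarith)

/-- A finer grid has a point strictly inside each cell of a coarser one, near any point of it. -/
lemma exists_fine_grid_point {N M : ℕ} (hN : 1 ≤ N) (hNM : N < M) {μ : ℝ} (h0 : 0 ≤ μ) :
    ∃ j : ℕ, ((⌊N * μ⌋₊ : ℕ) : ℝ) / N < (j : ℝ) / M ∧
      (j : ℝ) / M < ((⌊N * μ⌋₊ : ℕ) + 1 : ℝ) / N ∧ |μ - (j : ℝ) / M| ≤ 1 / M := by
  have hN0 : (0 : ℝ) < N := by exact_mod_cast hN
  have hMN : (N : ℝ) < M := by exact_mod_cast hNM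
  have hM0 : (0 : ℝ) < M := hN0.trans hMN
  have hk := Nat.floor_le (mul_nonneg hN0.le h0)
  have hk' := Nat.lt_floor_add_one (N * μ)
  have hj := Nat.floor_le (mul_nonneg hM0.le h0)
  have hj' := Nat.lt_floor_add_one (M * μ)
  have hk1 : ((⌊N * μ⌋₊ : ℕ) : ℝ) / N ≤ μ := by rw [div_le_iff₀ hN0]; linarith
  have hk2 : μ < ((⌊N * μ⌋₊ : ℕ) + 1 : ℝ) / N := by rw [lt_div_iff₀ hN0]; linarith
  have hj1 : ((⌊M * μ⌋₊ : ℕ) : ℝ) / M ≤ μ := by rw [div_le_iff₀ hM0]; linarith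
  have hj2 : μ < ((⌊M * μ⌋₊ : ℕ) : ℝ) / M + 1 / M := by
    rw [← add_div, lt_div_iff₀ hM0]; linarith
  by_cases hc : ((⌊N * μ⌋₊ : ℕ) : ℝ) / N < ((⌊M * μ⌋₊ : ℕ) : ℝ) / M
  · refine ⟨⌊M * μ⌋₊, hc, hj1.trans_lt hk2, ?_⟩
    rw [abs_of_nonneg (by linarith)]
    linarith
  · have hlt : (1 : ℝ) / M < 1 / N := one_div_lt_one_div_of_lt hN0 hMN
    refine ⟨⌊M * μ⌋₊ + 1, ?_, ?_, ?_⟩ <;> push_cast <;> rw [add_div]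
    · linarith
    · rw [add_div]; linarith
    · rw [abs_le]; constructor <;> linarith

lemma inGrid_zero (N : ℕ) : inGrid N 0 := ⟨0, Nat.zero_le _, by simp⟩

lemma inGrid_one {N : ℕ} (hN : 1 ≤ N) : inGrid N 1 :=
  ⟨N, le_rfl, (div_self (by exact_mod_cast (by omega : N ≠ 0))).symm⟩

lemma dEM_self {S1 S2 : Type} [Fintype S1] [Fintype S2] (θ : InfoStruct S1 S2) :
    dEM θ θ ≤ 0 := by
  refine Real.sSup_le ?_ le_rfl
  rintro r ⟨h, -, rfl⟩
  simp

/-- If the state is deterministic, every report is `0` or `1`. -/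
lemma report_eq_of_prior {ι : Type} [Fintype ι] {μ : ℝ} {p x : ι → ℝ} (hp : IsReportLaw μ p x)
    (hμ : μ = 0 ∨ μ = 1) {i : ι} (hi : p i ≠ 0) : x i = 0 ∨ x i = 1 := by
  rcases hμ with hμ | hμ
  · have := hp.sum_weight true
    rw [hμ, stateProb_true, Finset.sum_eq_zero_iff_of_nonneg fun i _ => hp.weight_nonneg _ i]
      at this
    exact Or.inl ((mul_eq_zero.1 (this i (Finset.mem_univ _))).resolve_left hi)
  · have := hp.sum_weight false
    rw [hμ, stateProb_false, sub_self,
      Finset.sum_eq_zero_iff_of_nonneg fun i _ => hp.weight_nonneg _ i] at this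
    have := (mul_eq_zero.1 (this i (Finset.mem_univ _))).resolve_left hi
    rw [stateProb_false] at this
    exact Or.inr (by linarith)

lemma reportsInGrid_of_prior {N : ℕ} (hN : 1 ≤ N) {θ : InfoStruct Bool Bool}
    (hμ : θ.prior = 0 ∨ θ.prior = 1) : reportsInGrid N θ := by
  refine ⟨fun i => ?_, fun j => ?_⟩
  · by_cases hi : θ.p1 i = 0
    · rw [InfoStruct.x1, hi, div_zero]
      exact inGrid_zero N
    · rcases report_eq_of_prior θ.isReportLaw_one hμ hi with h | h <;> rw [h]
      exacts [inGrid_zero N, inGrid_one hN]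
  · by_cases hj : θ.p2 j = 0
    · rw [InfoStruct.x2, hj, div_zero]
      exact inGrid_zero N
    · rcases report_eq_of_prior θ.isReportLaw_two hμ hj with h | h <;> rw [h]
      exacts [inGrid_zero N, inGrid_one hN]

lemma abs_sub_center_le {h : ℝ → ℝ → ℝ}
    (hh : ∀ a b a' b', |h a b - h a' b'| ≤ |a - a'| + |b - b'|) {a b : ℝ}
    (ha0 : 0 ≤ a) (ha1 : a ≤ 1) (hb0 : 0 ≤ b) (hb1 : b ≤ 1) :
    |h a b - h (1 / 2) (1 / 2)| ≤ 1 := by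
  have h1 : |a - 1 / 2| ≤ 1 / 2 := abs_le.2 ⟨by linarith, by linarith⟩
  have h2 : |b - 1 / 2| ≤ 1 / 2 := abs_le.2 ⟨by linarith, by linarith⟩
  linarith [hh a b (1 / 2) (1 / 2)]

/-- `Θ̄_{N,M}` is a `(12N/M + 8/√N + 4/N, d_EM)`-covering of `Θ̄`: for all
`M > N ≥ 1`, every binary-signal conditionally independent information structure is within
earth mover's distance `12N/M + 8/√N + 4/N` (of report distributions) of one whose reports
lie in the grid `[1/N]` and whose prior lies in `[1/M]`. -/
theorem dEM_covering_gridNM (N M : ℕ) (hN : 1 ≤ N) (hNM : N < M)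
    (θ : InfoStruct Bool Bool) :
    ∃ θ' : InfoStruct Bool Bool, reportsInGrid N θ' ∧ inGrid M θ'.prior ∧
      dEM θ θ' ≤ 12 * (N : ℝ) / (M : ℝ) + 8 / Real.sqrt (N : ℝ) + 4 / (N : ℝ) := by
  have hN0 : (0 : ℝ) < N := by exact_mod_cast hN
  have hM0 : (0 : ℝ) < M := by exact_mod_cast (by omega : 0 < M)
  have hp := θ.isReportLaw_one
  have hq := θ.isReportLaw_two
  have hμ0 : 0 ≤ θ.prior := by
    rw [← hp.mean_eq]
    exact Finset.sum_nonneg fun i _ => hp.weight_nonneg true i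
  have hμ1 : θ.prior ≤ 1 := by
    have := hp.sum_weight false
    have h' : 0 ≤ stateProb false θ.prior := this ▸
      Finset.sum_nonneg fun i _ => hp.weight_nonneg false i
    rw [stateProb_false] at h'
    linarith
  by_cases hdeg : θ.prior = 0 ∨ θ.prior = 1
  · refine ⟨θ, reportsInGrid_of_prior hN hdeg, ?_, (dEM_self θ).trans (by positivity)⟩
    rcases hdeg with h | h <;> rw [h]
    exacts [inGrid_zero M, inGrid_one (by omega)]
  rw [not_or] at hdeg
  have h0 : 0 < θ.prior := lt_of_le_of_ne hμ0 (Ne.symm hdeg.1)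
  have h1 : θ.prior < 1 := lt_of_le_of_ne hμ1 hdeg.2
  obtain ⟨l, r, hl, hr, hrN, hx, hxd⟩ := exists_grid_endpoints hN hp h1
  obtain ⟨l', r', hl', hr', hrN', hy, hyd⟩ := exists_grid_endpoints hN hq h1
  obtain ⟨j, hj1, hj2, hjd⟩ := exists_fine_grid_point hN hNM hμ0
  generalize hk : ⌊N * θ.prior⌋₊ = k at *
  have cell : ∀ {l r : ℕ}, l ≤ k → k + 1 ≤ r → r ≤ N → 0 ≤ (l : ℝ) / N ∧ (r : ℝ) / N ≤ 1 ∧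
      (l : ℝ) / N < (j : ℝ) / M ∧ (j : ℝ) / M < (r : ℝ) / N ∧
      (1 : ℝ) / N ≤ (r : ℝ) / N - (l : ℝ) / N := fun {l r} hl hr hrN => by
    have c1 : (l : ℝ) ≤ k := by exact_mod_cast hl
    have c2 : (k : ℝ) + 1 ≤ r := by exact_mod_cast hr
    have c3 : (r : ℝ) ≤ N := by exact_mod_cast hrN
    refine ⟨by positivity, (div_le_one hN0).2 c3, lt_of_le_of_lt (by gcongr) hj1,
      hj2.trans_le (by gcongr), ?_⟩
    rw [← sub_div]
    gcongr
    linarith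
  obtain ⟨hL0, hH1, hLj, hjH, hLH⟩ := cell hl hr hrN
  obtain ⟨hL0', hH1', hLj', hjH', hLH'⟩ := cell hl' hr' hrN'
  set L := (l : ℝ) / N
  set H := (r : ℝ) / N
  set L' := (l' : ℝ) / N
  set H' := (r' : ℝ) / N
  set ν := (j : ℝ) / M with hν
  have hν0 : 0 < ν := by linarith
  have hν1 : ν < 1 := by linarith
  obtain ⟨hLμ, hμH⟩ := hp.mean_mem hx
  obtain ⟨hLμ', hμH'⟩ := hq.mean_mem hy
  have P₁ := isReportLaw_twoPoint hL0 hH1 (by linarith) hLμ hμH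
  have Q₁ := isReportLaw_twoPoint hL0' hH1' (by linarith) hLμ' hμH'
  have P₂ := isReportLaw_twoPoint hL0 hH1 (by linarith) hLj.le hjH.le
  have Q₂ := isReportLaw_twoPoint hL0' hH1' (by linarith) hLj'.le hjH'.le
  have pP := fun i => (twoPointLaw_pos hLj hjH i).ne'
  have pQ := fun i => (twoPointLaw_pos hLj' hjH' i).ne'
  refine ⟨InfoStruct.ofReports hν0 hν1 P₂ Q₂, ⟨fun i => ?_, fun i => ?_⟩, ?_, ?_⟩
  · rw [ofReports_x1 _ _ _ _ (pP i)]
    cases i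
    exacts [⟨l, by omega, rfl⟩, ⟨r, hrN, rfl⟩]
  · rw [ofReports_x2 _ _ _ _ (pQ i)]
    cases i
    exacts [⟨l', by omega, rfl⟩, ⟨r', hrN', rfl⟩]
  · rw [ofReports_prior]
    refine ⟨j, ?_, rfl⟩
    have := (div_lt_one hM0).1 hν1
    exact_mod_cast this.le
  · refine Real.sSup_le ?_ (by positivity)
    rintro _ ⟨h, hh, rfl⟩
    set g : ℝ → ℝ → ℝ := fun a b => h a b - h (1 / 2) (1 / 2) with hg
    have hgL : ∀ a b a' b', |g a b - g a' b'| ≤ |a - a'| + |b - b'| := fun a b a' b' => by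
      simpa [hg] using hh a b a' b'
    have hcenter : θ.expect h - (InfoStruct.ofReports hν0 hν1 P₂ Q₂).expect h =
        θ.expect g - (InfoStruct.ofReports hν0 hν1 P₂ Q₂).expect g := by
      rw [hg, InfoStruct.expect_sub_const, InfoStruct.expect_sub_const]
      ring
    rw [hcenter, θ.expect_eq_reportExpect h0 h1, expect_ofReports hν0 hν1 P₂ Q₂ pP pQ]
    have s1 := abs_reportExpect_sub_twoPoint_le h0 h1 hp hq hgL hL0 hH1 (by linarith) hx hxd
    have s2 := abs_reportExpect_sub_twoPoint_le h0 h1 hq P₁ (h := fun a b => g b a)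
      (fun a b a' b' => (hgL b a b' a').trans_eq (add_comm _ _)) hL0' hH1' (by linarith) hy hyd
    rw [← reportExpect_swap _ (twoPointLaw L H θ.prior) _ _ _ g,
      ← reportExpect_swap _ (twoPointLaw L H θ.prior) _ _ _ g] at s2
    have s3 := abs_reportExpect_sub_le h0 h1 hν0 hν1 (p := twoPointLaw L H θ.prior)
      (q' := twoPointLaw L' H' ν) P₂ Q₁ (h := g)
      fun i j => abs_sub_center_le hh (P₂.report_nonneg i) (P₂.report_le i) (Q₂.report_nonneg j)
        (Q₂.report_le j)
    have t1 := sum_abs_twoPointLaw_sub (by positivity) hLH θ.prior ν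
    have t2 := sum_abs_twoPointLaw_sub (by positivity) hLH' θ.prior ν
    have hd : |θ.prior - ν| / (1 / N) ≤ N / M := by
      rw [div_div_eq_mul_div, div_one, div_eq_mul_one_div (N : ℝ), mul_comm]
      gcongr
    have hd' : (1 : ℝ) / M ≤ N / M := by gcongr; exact_mod_cast hN
    have hs : 0 ≤ 8 / Real.sqrt N := by positivity
    have e1 : 12 * (N : ℝ) / M = 12 * (N / M) := by ring
    have e2 : 4 / (N : ℝ) = 4 * (1 / N) := by ring
    have hNM0 : 0 ≤ (N : ℝ) / M := by positivity
    have a1 := le_of_abs_le s1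
    have a2 := le_of_abs_le s2
    have a3 := le_of_abs_le s3
    rw [e1, e2]
    linarith
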